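/- Let M ≥ 1, define Φ_phys : L(H_N) → L(H_{N+M}) by Φ_phys(A) := (Π_phys^{(N)} A Π_phys^{(N)}) ⊗ Π_phys^{(M)}, and let Trel_M := (Φ_phys)† be its adjoint with respect to the Hilbert–Schmidt inner product, i.e. the unique map with tr(Φ_phys(A) ρ) = tr(A · Trel_M(ρ)) for all A ∈ L(H_N), ρ ∈ L(H_{N+M}). Then: (a) Trel_M(ρ) = Tr_M[(Π_phys^{(N)} ⊗ Π_phys^{(M)}) ρ (Π_phys^{(N)} ⊗ Π_phys^{(M)})], where Tr_M is the standard partial trace over the last M tensor factors; (b) Trel_M maps A_phys^{(N+M)} onto A_phys^{(N)}; (c) tr(Trel_M(ρ)) = tr(ρ) for every ρ supported on the range of Π_phys^{(N)} ⊗ Π_phys^{(M)} (i.e. ρ = (Π_phys^{(N)} ⊗ Π_phys^{(M)}) ρ (Π_phys^{(N)} ⊗ Π_phys^{(M)})); (d) Trel_M preserves observational equivalence: if Π_inv^{(N+M)}(ρ) = Π_inv^{(N+M)}(σ) then Trel_M(ρ) = Trel_M(σ). -/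

import Mathlib

noncomputable section

open Matrix

namespace QRF

section Defs

variable (G : Type) [Fintype G] [DecidableEq G] [CommGroup G]

/-- The `K`-particle Hilbert space `ℂ^{G^K}` (as functions `G^K → ℂ`). -/
abbrev Vec (K : ℕ) : Type := (Fin K → G) → ℂ

/-- Linear operators on the `K`-particle Hilbert space. -/
abbrev Op (K : ℕ) : Type := Matrix (Fin K → G) (Fin K → G) ℂ

variable {G}

/-- The standard basis vector `|x⟩`. -/
def ket {K : ℕ} (x : Fin K → G) : Vec G K := fun y => if y = x then 1 else 0

/-- The global translation `T_g`, `T_g |x₁,…,x_K⟩ = |g x₁, …, g x_K⟩`. -/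
def trans {K : ℕ} (g : G) : Op G K :=
  Matrix.of fun x y => if x = (fun i => g * y i) then 1 else 0

/-- The configuration `(g, h₁ g, …, h_k g)`, i.e. `|g, hg⟩`. -/
def cfg {k : ℕ} (h : Fin k → G) (g : G) : Fin (k + 1) → G :=
  Fin.cons g fun i => h i * g

/-- The inner product `⟨v, w⟩` (antilinear in the first argument). -/
def inn {K : ℕ} (v w : Vec G K) : ℂ := star v ⬝ᵥ w

/-- The rank-one operator `|v⟩⟨w|`. -/
def outer {K : ℕ} (v w : Vec G K) : Op G K :=
  Matrix.of fun x y => v x * (starRingEnd ℂ) (w y)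

/-- The matrix element `⟨v|A|w⟩`. -/
def melem {K : ℕ} (v : Vec G K) (A : Op G K) (w : Vec G K) : ℂ :=
  star v ⬝ᵥ A.mulVec w

/-- The Hilbert–Schmidt inner product `⟨A,B⟩ := tr(A† B)`. -/
def hsInner {K : ℕ} (A B : Op G K) : ℂ := (Aᴴ * B).trace

variable (G)

/-- The symmetry group `U_sym` of relation-conditional global translations
(for `k+1` particles). -/
def Usym (k : ℕ) : Set (Op G (k + 1)) :=
  {U | U ∈ Matrix.unitaryGroup (Fin (k + 1) → G) ℂ ∧
    ∃ c : (Fin k → G) → G, ∀ (h : Fin k → G) (g : G),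
      U.mulVec (ket (cfg h g)) = (trans (c h)).mulVec (ket (cfg h g))}

/-- The characters of `G`: monoid homomorphisms `G → ℂ` of modulus one. -/
def Ghat : Type := {χ : G →* ℂ // ∀ g : G, ‖χ g‖ = 1}

/-- The trivial character `𝟙`. -/
instance : One (Ghat G) := ⟨⟨1, fun g => by simp⟩⟩

variable {G}

/-- The vector `|h;χ⟩ := |G|^{-1/2} ∑_{g ∈ G} χ(g⁻¹) |g, hg⟩`. -/
def relKet {k : ℕ} (h : Fin k → G) (χ : Ghat G) : Vec G (k + 1) :=
  ((Real.sqrt (Fintype.card G) : ℂ))⁻¹ • ∑ g : G, χ.1 g⁻¹ • ket (cfg h g)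

variable (G)

/-- The relational subspace `H_phys = span{|h;𝟙⟩}`. -/
def Hphys (k : ℕ) : Submodule ℂ (Vec G (k + 1)) :=
  Submodule.span ℂ {v | ∃ h : Fin k → G, v = relKet h (1 : Ghat G)}

/-- `Π_phys = ∑_h |h;𝟙⟩⟨h;𝟙|`, the orthogonal projection onto `H_phys`. -/
def Piphys (k : ℕ) : Op G (k + 1) :=
  ∑ h : Fin k → G, outer (relKet h (1 : Ghat G)) (relKet h (1 : Ghat G))

variable {G}

/-- `Π_{h;χ≠𝟙} = ∑_{χ ∈ Ĝ, χ ≠ 𝟙} |h;χ⟩⟨h;χ|`. -/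
def PiNot1 {k : ℕ} (h : Fin k → G) : Op G (k + 1) :=
  ∑ᶠ (χ : Ghat G) (_ : χ ≠ 1), outer (relKet h χ) (relKet h χ)

variable (G)

/-- The invariant algebra `A_inv`. -/
def Ainv (k : ℕ) : Set (Op G (k + 1)) :=
  {A | ∀ U ∈ Usym G k, U * A * Uᴴ = A}

/-- The incoherent group average (twirl) `Π_inv` over `U_sym`. -/
def Piinv (k : ℕ) (ρ : Op G (k + 1)) : Op G (k + 1) :=
  (Nat.card ↥(Usym G k) : ℂ)⁻¹ • ∑ᶠ U ∈ Usym G k, U * ρ * Uᴴ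

/-- The algebra `A_phys` of relational observables (operators supported on `H_phys`). -/
def Aphys (k : ℕ) : Set (Op G (k + 1)) :=
  {A | A = Piphys G k * A * Piphys G k}

/-- The algebra `A_alg`. -/
def Aalg (k : ℕ) : Set (Op G (k + 1)) :=
  {X | ∃ B ∈ Aphys G k, ∃ a : (Fin k → G) → ℂ,
      X = B + ∑ h : Fin k → G, a h • PiNot1 h}

variable {G}

/-- The vector `|e⟩_i ⊗ φ`. -/
def insVec {k : ℕ} (i : Fin (k + 1)) (φ : (Fin k → G) → ℂ) : Vec G (k + 1) :=
  fun x => if x i = 1 then φ (fun j => x (i.succAbove j)) else 0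

/-- The operator `|e⟩⟨e|_i ⊗ A`. -/
def eAop {k : ℕ} (i : Fin (k + 1)) (A : Matrix (Fin k → G) (Fin k → G) ℂ) :
    Op G (k + 1) :=
  Matrix.of fun x y =>
    if x i = 1 ∧ y i = 1 then
      A (fun j => x (i.succAbove j)) (fun j => y (i.succAbove j))
    else 0

/-- `ψ` is `i`-alignable. -/
def IAlignable {k : ℕ} (i : Fin (k + 1)) (ψ : Vec G (k + 1)) : Prop :=
  ∃ (θ : ℝ) (U : Op G (k + 1)) (φ : (Fin k → G) → ℂ),
    U ∈ Usym G k ∧ ψ = Complex.exp (θ * Complex.I) • U.mulVec (insVec i φ)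

/-- `ψ` is alignable. -/
def Alignable {k : ℕ} (ψ : Vec G (k + 1)) : Prop := ∃ i, IAlignable i ψ

/-- Symmetry equivalence of state vectors (up to a global phase). -/
def SymmEquiv {k : ℕ} (ψ ψ' : Vec G (k + 1)) : Prop :=
  ∃ (θ : ℝ) (U : Op G (k + 1)),
    U ∈ Usym G k ∧ ψ' = Complex.exp (θ * Complex.I) • U.mulVec ψ

/-- `P` is the orthogonal projection of operator space onto the set `S`,
with respect to the Hilbert–Schmidt inner product. -/
def IsHSProj {K : ℕ} (S : Set (Op G K)) (P : Op G K →ₗ[ℂ] Op G K) : Prop :=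
  (∀ ρ, P ρ ∈ S) ∧ (∀ A ∈ S, P A = A) ∧
    ∀ ρ σ, hsInner (P ρ) σ = hsInner ρ (P σ)

/-- First `n+1` components of an `(n+1)+(m+1)`-particle configuration. -/
def split1 {n m : ℕ} (x : Fin (n + m + 1 + 1) → G) : Fin (n + 1) → G :=
  fun i => x ⟨i.1, by have := i.2; omega⟩

/-- Last `m+1` components of an `(n+1)+(m+1)`-particle configuration. -/
def split2 {n m : ℕ} (x : Fin (n + m + 1 + 1) → G) : Fin (m + 1) → G :=
  fun i => x ⟨n + 1 + i.1, by have := i.2; omega⟩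

/-- The tensor product `A ⊗ B` of operators, under the identification
`H_{N+M} ≅ H_N ⊗ H_M`, `|x,y⟩ ↦ |x⟩ ⊗ |y⟩`. -/
def tensorOp {n m : ℕ} (A : Op G (n + 1)) (B : Op G (m + 1)) :
    Op G (n + m + 1 + 1) :=
  Matrix.of fun x y => A (split1 x) (split1 y) * B (split2 x) (split2 y)

/-- Concatenation `(h, g⃗)` of relation tuples. -/
def relcat {n m : ℕ} (h : Fin n → G) (gv : Fin (m + 1) → G) :
    Fin (n + m + 1) → G :=
  (Fin.append h gv : Fin (n + (m + 1)) → G)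

/-- Joining of configurations `(x, z)`. -/
def join {n m : ℕ} (x : Fin (n + 1) → G) (z : Fin (m + 1) → G) :
    Fin (n + m + 1 + 1) → G :=
  fun i => if hi : i.1 < n + 1 then x ⟨i.1, hi⟩
           else z ⟨i.1 - (n + 1), by have := i.2; omega⟩

/-- The standard partial trace over the last `m+1` particles. -/
def ptraceM {n m : ℕ} (ρ : Op G (n + m + 1 + 1)) : Op G (n + 1) :=
  Matrix.of fun x y => ∑ z : Fin (m + 1) → G, ρ (join x z) (join y z)

end Defs

section TensorProduct

variable {G : Type}

lemma cfg_eq_iff [CommGroup G] {k : ℕ} (x : Fin (k + 1) → G) (h : Fin k → G) (g : G) :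
    x = cfg h g ↔ g = x 0 ∧ h = fun i => x i.succ * (x 0)⁻¹ := by
  constructor
  · rintro rfl
    simp [cfg]
  · rintro ⟨rfl, rfl⟩
    funext i
    refine Fin.cases ?_ (fun j => ?_) i <;> simp [cfg]

@[simp] lemma split1_join {n m : ℕ} (x : Fin (n + 1) → G) (z : Fin (m + 1) → G) :
    split1 (join x z) = x := by
  funext i
  simp only [split1, join]
  exact dif_pos i.2

@[simp] lemma split2_join {n m : ℕ} (x : Fin (n + 1) → G) (z : Fin (m + 1) → G) :
    split2 (join x z) = z := by
  funext i
  have hi : ¬ n + 1 + i.1 < n + 1 := by omega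
  simp only [split2, join, dif_neg hi]
  congr 1
  ext
  simp

@[simp] lemma join_split {n m : ℕ} (x : Fin (n + m + 1 + 1) → G) :
    join (split1 x) (split2 x) = x := by
  funext i
  by_cases hi : i.1 < n + 1
  · simp [join, split1, hi]
  · simp only [join, split2, hi, dite_false]
    congr 1
    ext
    simp only
    omega

/-- The identification `G^{N+M} ≃ G^N × G^M`. -/
def splitEquiv (G : Type) (n m : ℕ) :
    (Fin (n + m + 1 + 1) → G) ≃ (Fin (n + 1) → G) × (Fin (m + 1) → G) where
  toFun x := (split1 x, split2 x)
  invFun p := join p.1 p.2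
  left_inv x := by simp
  right_inv p := by simp

lemma sum_eq_sum_join [Fintype G] {n m : ℕ} (f : (Fin (n + m + 1 + 1) → G) → ℂ) :
    ∑ x, f x = ∑ x : Fin (n + 1) → G, ∑ z : Fin (m + 1) → G, f (join x z) := by
  rw [← Equiv.sum_comp (splitEquiv G n m).symm, Fintype.sum_prod_type]
  rfl

lemma conjTranspose_tensorOp {n m : ℕ} (A : Op G (n + 1)) (B : Op G (m + 1)) :
    (tensorOp A B)ᴴ = tensorOp Aᴴ Bᴴ := by
  ext x y
  simp [tensorOp]

lemma tensorOp_mul [Fintype G] {n m : ℕ} (A A' : Op G (n + 1)) (B B' : Op G (m + 1)) :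
    tensorOp A B * tensorOp A' B' = tensorOp (A * A') (B * B') := by
  ext x y
  simp only [Matrix.mul_apply, tensorOp, Matrix.of_apply, sum_eq_sum_join, split1_join,
    split2_join, Finset.sum_mul_sum]
  exact Finset.sum_congr rfl fun _ _ => Finset.sum_congr rfl fun _ _ => mul_mul_mul_comm _ _ _ _

lemma trans_eq_tensorOp [DecidableEq G] [CommGroup G] {n m : ℕ} (g : G) :
    (trans g : Op G (n + m + 1 + 1)) = tensorOp (trans g : Op G (n + 1)) (trans g) := by
  ext x y
  have h : x = (fun i => g * y i) ↔
      split1 x = (fun i => g * split1 y i) ∧ split2 x = (fun i => g * split2 y i) := by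
    rw [← (splitEquiv G n m).injective.eq_iff]
    exact Prod.ext_iff
  simp only [trans, tensorOp, Matrix.of_apply, h, ite_and, ite_mul, one_mul, zero_mul]

lemma ptraceM_tensorOp [Fintype G] {n m : ℕ} (A : Op G (n + 1)) (B : Op G (m + 1)) :
    ptraceM (tensorOp A B) = B.trace • A := by
  ext x y
  simp [ptraceM, tensorOp, Matrix.trace, ← Finset.mul_sum, mul_comm]

lemma trace_tensorOp_one_mul [Fintype G] [DecidableEq G] {n m : ℕ} (A : Op G (n + 1))
    (ρ : Op G (n + m + 1 + 1)) :
    (tensorOp A 1 * ρ).trace = (A * ptraceM ρ).trace := by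
  simp only [Matrix.trace, Matrix.diag, Matrix.mul_apply, sum_eq_sum_join, tensorOp,
    Matrix.of_apply, split1_join, split2_join, ptraceM, Matrix.one_apply, Finset.mul_sum]
  refine Finset.sum_congr rfl fun x _ => ?_
  rw [Finset.sum_comm]
  simp

end TensorProduct

section PhysicalProjection

variable {G : Type} [Fintype G] [DecidableEq G] [CommGroup G]

lemma relKet_one_apply {k : ℕ} (h : Fin k → G) (x : Fin (k + 1) → G) :
    relKet h (1 : Ghat G) x =
      if h = (fun i => x i.succ * (x 0)⁻¹) then ((Real.sqrt (Fintype.card G) : ℂ))⁻¹ else 0 := by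
  have hone : ∀ g : G, (1 : Ghat G).1 g = 1 := fun _ => rfl
  simp only [relKet, ket, Pi.smul_apply, Finset.sum_apply, hone, smul_eq_mul, one_mul,
    cfg_eq_iff, ite_and]
  simp

lemma Piphys_eq_sum_trans (k : ℕ) :
    Piphys G k = (Fintype.card G : ℂ)⁻¹ • ∑ g : G, trans g := by
  ext x y
  have hs : ((Real.sqrt (Fintype.card G) : ℂ))⁻¹ * ((Real.sqrt (Fintype.card G) : ℂ))⁻¹ =
      (Fintype.card G : ℂ)⁻¹ := by
    rw [← mul_inv, ← Complex.ofReal_mul, Real.mul_self_sqrt (by positivity)]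
    simp
  have htrans : ∀ g : G, x = (fun i => g * y i) ↔
      g = x 0 * (y 0)⁻¹ ∧
        (fun i : Fin k => x i.succ * (x 0)⁻¹) = fun i => y i.succ * (y 0)⁻¹ := by
    intro g
    constructor
    · rintro rfl
      refine ⟨by simp, funext fun i => ?_⟩
      rw [mul_inv, mul_mul_mul_comm, mul_inv_cancel, one_mul]
    · rintro ⟨rfl, h⟩
      funext i
      refine Fin.cases (by simp) (fun j => ?_) i
      have := congrFun h j
      rw [mul_assoc, mul_comm (y 0)⁻¹, ← this, mul_comm, inv_mul_cancel_right]
  simp only [Piphys, Matrix.sum_apply, Matrix.smul_apply, outer, trans, Matrix.of_apply,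
    relKet_one_apply, htrans, ite_and, smul_eq_mul]
  simp [apply_ite (starRingEnd ℂ), hs, eq_comm]

lemma trans_mul_trans {K : ℕ} (g h : G) :
    (trans g * trans h : Op G K) = trans (g * h) := by
  ext x y
  simp [Matrix.mul_apply, trans, mul_assoc]

lemma trans_mul_Piphys {k : ℕ} (g : G) : trans g * Piphys G k = Piphys G k := by
  rw [Piphys_eq_sum_trans, Matrix.mul_smul, Matrix.mul_sum]
  simp only [trans_mul_trans]
  exact congrArg _ (Equiv.sum_comp (Equiv.mulLeft g) fun h => (trans h : Op G (k + 1)))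

lemma Piphys_mul_of_trans_mul {k : ℕ} {X : Op G (k + 1)} (hX : ∀ g : G, trans g * X = X) :
    Piphys G k * X = X := by
  rw [Piphys_eq_sum_trans, Matrix.smul_mul, Matrix.sum_mul]
  simp [hX, ← Nat.cast_smul_eq_nsmul ℂ, smul_smul]

lemma Piphys_mul_self (k : ℕ) : Piphys G k * Piphys G k = Piphys G k :=
  Piphys_mul_of_trans_mul trans_mul_Piphys

lemma conjTranspose_Piphys (k : ℕ) : (Piphys G k)ᴴ = Piphys G k := by
  ext x y
  simp [Piphys, Matrix.sum_apply, outer, mul_comm]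

lemma trace_Piphys_ne_zero (k : ℕ) : (Piphys G k).trace ≠ 0 := by
  have hdiag : ∀ x : Fin (k + 1) → G, Piphys G k x x = (Fintype.card G : ℂ)⁻¹ := by
    intro x
    have hx : ∀ g : G, x = (fun i => g * x i) ↔ g = 1 := fun g =>
      ⟨fun h => by simpa using congrFun h 0, by rintro rfl; simp⟩
    simp [Piphys_eq_sum_trans, Matrix.sum_apply, trans, hx]
  simp [Matrix.trace, hdiag]

lemma Piphys_mul_tensorOp (n m : ℕ) :
    Piphys G (n + m + 1) * tensorOp (Piphys G n) (Piphys G m) =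
      tensorOp (Piphys G n) (Piphys G m) :=
  Piphys_mul_of_trans_mul fun g => by
    rw [trans_eq_tensorOp, tensorOp_mul, trans_mul_Piphys, trans_mul_Piphys]

lemma tensorOp_mul_Piphys (n m : ℕ) :
    tensorOp (Piphys G n) (Piphys G m) * Piphys G (n + m + 1) =
      tensorOp (Piphys G n) (Piphys G m) := by
  simpa [Matrix.conjTranspose_mul, conjTranspose_tensorOp, conjTranspose_Piphys]
    using congrArg conjTranspose (Piphys_mul_tensorOp (G := G) n m)

lemma trans_mulVec_ket_cfg {k : ℕ} (a : G) (h : Fin k → G) (g : G) :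
    (trans a : Op G (k + 1)) *ᵥ ket (cfg h g) = ket (cfg h (a * g)) := by
  have hc : (fun i => a * cfg h g i) = cfg h (a * g) := by
    funext i
    refine Fin.cases ?_ (fun j => ?_) i <;> simp [cfg, mul_left_comm]
  funext x
  simp [Matrix.mulVec, dotProduct, trans, ket, ← hc]

lemma Usym_mulVec_relKet {k : ℕ} {U : Op G (k + 1)} (hU : U ∈ Usym G k) (h : Fin k → G) :
    U *ᵥ relKet h (1 : Ghat G) = relKet h 1 := by
  obtain ⟨-, c, hc⟩ := hU
  have hone : ∀ g : G, (1 : Ghat G).1 g = 1 := fun _ => rfl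
  simp only [relKet, hone, one_smul, Matrix.mulVec_smul, Matrix.mulVec_sum, hc,
    trans_mulVec_ket_cfg]
  exact congrArg _ (Equiv.sum_comp (Equiv.mulLeft (c h)) fun g => ket (cfg h g))

lemma Usym_mul_Piphys {k : ℕ} {U : Op G (k + 1)} (hU : U ∈ Usym G k) :
    U * Piphys G k = Piphys G k := by
  rw [Piphys, Matrix.mul_sum]
  refine Finset.sum_congr rfl fun h _ => ?_
  change U * Matrix.vecMulVec _ (star _) = Matrix.vecMulVec _ (star _)
  rw [Matrix.mul_vecMulVec, Usym_mulVec_relKet hU]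

lemma Piphys_mul_Usym {k : ℕ} {U : Op G (k + 1)} (hU : U ∈ Usym G k) :
    Piphys G k * U = Piphys G k := by
  have h : Piphys G k * Uᴴ = Piphys G k := by
    simpa [Matrix.conjTranspose_mul, conjTranspose_Piphys]
      using congrArg conjTranspose (Usym_mul_Piphys hU)
  have hunit : Uᴴ * U = 1 := Matrix.mem_unitaryGroup_iff'.1 hU.1
  rw [← h, Matrix.mul_assoc, hunit, h, Matrix.mul_one]

lemma Usym_conjTranspose_mul_Piphys {k : ℕ} {U : Op G (k + 1)} (hU : U ∈ Usym G k) :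
    Uᴴ * Piphys G k = Piphys G k := by
  simpa [Matrix.conjTranspose_mul, conjTranspose_Piphys]
    using congrArg conjTranspose (Piphys_mul_Usym hU)

lemma Usym_finite (k : ℕ) : (Usym G k).Finite := by
  choose! c hc using fun U (hU : U ∈ Usym G k) => hU.2
  refine Set.Finite.of_finite_image (f := c) (Set.toFinite _) fun U hU V hV hUV => ?_
  ext x y
  have hy := (cfg_eq_iff y _ _).2 ⟨rfl, rfl⟩
  have hcol : U *ᵥ ket y = V *ᵥ ket y := by
    rw [hy, hc U hU, hc V hV, hUV]
  simpa [Matrix.mulVec, dotProduct, ket] using congrFun hcol x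

lemma one_mem_Usym (k : ℕ) : (1 : Op G (k + 1)) ∈ Usym G k :=
  ⟨one_mem _, 1, fun h g => by simp [trans_mulVec_ket_cfg]⟩

lemma Piphys_mul_Piinv_mul_Piphys {k : ℕ} (ρ : Op G (k + 1)) :
    Piphys G k * Piinv G k ρ * Piphys G k = Piphys G k * ρ * Piphys G k := by
  have hterm : ∀ U ∈ Usym G k,
      Piphys G k * (U * ρ * Uᴴ) * Piphys G k = Piphys G k * ρ * Piphys G k := by
    intro U hU
    simp only [Matrix.mul_assoc, Usym_conjTranspose_mul_Piphys hU]
    rw [← Matrix.mul_assoc, Piphys_mul_Usym hU]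
  have hfin := Usym_finite (G := G) k
  have hcard : (hfin.toFinset.card : ℂ) ≠ 0 :=
    Nat.cast_ne_zero.2 (Finset.card_ne_zero.2 ⟨1, by simpa using one_mem_Usym k⟩)
  rw [Piinv, finsum_mem_eq_finite_toFinset_sum _ hfin, Nat.card_eq_card_finite_toFinset hfin,
    Matrix.mul_smul, Matrix.smul_mul, Matrix.mul_sum, Matrix.sum_mul,
    Finset.sum_congr rfl fun U hU => hterm U (hfin.mem_toFinset.1 hU), Finset.sum_const,
    ← Nat.cast_smul_eq_nsmul ℂ, inv_smul_smul₀ hcard]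

end PhysicalProjection

/-- Let `Trel_M` be the Hilbert–Schmidt adjoint of
`Φ_phys(A) = (Π_phys^{(N)} A Π_phys^{(N)}) ⊗ Π_phys^{(M)}`, i.e. the unique map with
`tr(Φ_phys(A) ρ) = tr(A ⬝ Trel_M(ρ))`. Then (a) `Trel_M(ρ)` is the standard partial
trace of `(Π_phys^{(N)} ⊗ Π_phys^{(M)}) ρ (Π_phys^{(N)} ⊗ Π_phys^{(M)})`; (b) it maps
`A_phys^{(N+M)}` onto `A_phys^{(N)}`; (c) it is trace-preserving on operators
supported on the range of `Π_phys^{(N)} ⊗ Π_phys^{(M)}`; (d) it preserves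
observational equivalence. -/
theorem stmt18 (G : Type) [Fintype G] [DecidableEq G] [CommGroup G] (n m : ℕ)
    (Trel : Op G (n + m + 1 + 1) →ₗ[ℂ] Op G (n + 1))
    (hadj : ∀ (A : Op G (n + 1)) (ρ : Op G (n + m + 1 + 1)),
      (tensorOp (Piphys G n * A * Piphys G n) (Piphys G m) * ρ).trace =
        (A * Trel ρ).trace) :
    (∀ ρ : Op G (n + m + 1 + 1),
      Trel ρ = ptraceM (tensorOp (Piphys G n) (Piphys G m) * ρ *
        tensorOp (Piphys G n) (Piphys G m))) ∧
    ((fun ρ => Trel ρ) '' Aphys G (n + m + 1) = Aphys G n) ∧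
    (∀ ρ : Op G (n + m + 1 + 1),
      ρ = tensorOp (Piphys G n) (Piphys G m) * ρ *
        tensorOp (Piphys G n) (Piphys G m) →
      (Trel ρ).trace = ρ.trace) ∧
    (∀ ρ σ : Op G (n + m + 1 + 1),
      Piinv G (n + m + 1) ρ = Piinv G (n + m + 1) σ → Trel ρ = Trel σ) := by
  have hQQ : tensorOp (Piphys G n) (Piphys G m) * tensorOp (Piphys G n) (Piphys G m) =
      tensorOp (Piphys G n) (Piphys G m) := by
    rw [tensorOp_mul, Piphys_mul_self, Piphys_mul_self]
  have hptrace : ∀ ρ : Op G (n + m + 1 + 1),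
      Trel ρ = ptraceM (tensorOp (Piphys G n) (Piphys G m) * ρ *
        tensorOp (Piphys G n) (Piphys G m)) := by
    intro ρ
    refine Matrix.ext_iff_trace_mul_left.2 fun A => ?_
    have hsplit : tensorOp (Piphys G n * A * Piphys G n) (Piphys G m) =
        tensorOp (Piphys G n) (Piphys G m) * tensorOp A 1 *
          tensorOp (Piphys G n) (Piphys G m) := by
      rw [tensorOp_mul, tensorOp_mul, Matrix.mul_one, Piphys_mul_self]
    rw [← hadj, ← trace_tensorOp_one_mul, hsplit, Matrix.mul_assoc, Matrix.mul_assoc,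
      Matrix.trace_mul_comm, Matrix.mul_assoc]
  refine ⟨hptrace, ?_, ?_, ?_⟩
  · apply Set.Subset.antisymm
    · rintro _ ⟨ρ, -, rfl⟩
      refine Matrix.ext_iff_trace_mul_left.2 fun A => ?_
      have hidem : Piphys G n * (Piphys G n * A * Piphys G n) * Piphys G n =
          Piphys G n * A * Piphys G n := by
        rw [Matrix.mul_assoc, Matrix.mul_assoc, Piphys_mul_self, ← Matrix.mul_assoc,
          ← Matrix.mul_assoc, Piphys_mul_self]
      have hcycle : (A * (Piphys G n * Trel ρ * Piphys G n)).trace =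
          (Piphys G n * A * Piphys G n * Trel ρ).trace := by
        rw [← Matrix.mul_assoc, Matrix.trace_mul_comm]
        simp only [Matrix.mul_assoc]
      change (A * Trel ρ).trace = (A * (Piphys G n * Trel ρ * Piphys G n)).trace
      rw [hcycle, ← hadj, ← hadj, hidem]
    · intro B hB
      have hB' : B = Piphys G n * B * Piphys G n := hB
      have hT : tensorOp B (Piphys G m) = tensorOp (Piphys G n) (Piphys G m) *
          tensorOp B (Piphys G m) * tensorOp (Piphys G n) (Piphys G m) := by
        rw [tensorOp_mul, tensorOp_mul, Piphys_mul_self, Piphys_mul_self, ← hB']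
      refine ⟨(Piphys G m).trace⁻¹ • tensorOp B (Piphys G m), ?_, ?_⟩
      · change _ = _
        rw [Matrix.mul_smul, Matrix.smul_mul, hT, Matrix.mul_assoc, Matrix.mul_assoc,
          Matrix.mul_assoc, Matrix.mul_assoc, tensorOp_mul_Piphys,
          ← Matrix.mul_assoc (Piphys G (n + m + 1)), Piphys_mul_tensorOp]
      · simp only
        rw [map_smul, hptrace, ← hT, ptraceM_tensorOp,
          inv_smul_smul₀ (trace_Piphys_ne_zero m)]
  · intro ρ hρ
    have h := hadj 1 ρ
    rw [Matrix.mul_one, Matrix.one_mul, Piphys_mul_self] at h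
    rw [← h, hρ, ← Matrix.mul_assoc, ← Matrix.mul_assoc, hQQ]
  · intro ρ σ h
    have hcompress : ∀ τ : Op G (n + m + 1 + 1),
        tensorOp (Piphys G n) (Piphys G m) * τ * tensorOp (Piphys G n) (Piphys G m) =
          tensorOp (Piphys G n) (Piphys G m) *
            (Piphys G (n + m + 1) * Piinv G (n + m + 1) τ * Piphys G (n + m + 1)) *
              tensorOp (Piphys G n) (Piphys G m) := by
      intro τ
      rw [Piphys_mul_Piinv_mul_Piphys, ← Matrix.mul_assoc, ← Matrix.mul_assoc,
        tensorOp_mul_Piphys, Matrix.mul_assoc _ (Piphys G (n + m + 1)), Piphys_mul_tensorOp]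
    rw [hptrace, hptrace, hcompress, hcompress σ, h]

end QRF

end
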